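/- arXiv:1709.06098 — 5 statements merged into one kernel-verified Lean document; each statement's English description precedes it below -/
import Mathlib

section
/- Let A be a commutative ring, M an A-module and x : M → M an A-linear endomorphism. Suppose M₁ and M₂ are A-modules such that the product modules M × M₁ and M × M₂ are both finite free A-modules. Then the determinant of the endomorphism x × id_{M₁} of M × M₁ equals the determinant of the endomorphism x × id_{M₂} of M × M₂. In particular, defining det_A(x|_M) as the determinant of the extension of x by the identity to any finite free module F with F ≅ M ⊕ M′ is independent of the choice of F. -/
/-- Let `A` be a commutative ring, `M` an `A`-module and `x : M →ₗ[A] M`.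
If `M₁`, `M₂` are `A`-modules such that `M × M₁` and `M × M₂` are finite free,
then the determinant of `x × id` on `M × M₁` equals the determinant of `x × id`
on `M × M₂`; hence `det_A(x|_M)` is well defined independently of the choice of
finite free module `F ≅ M ⊕ M'`. -/
theorem det_prodMap_id_independent_of_complement
    (A : Type*) [CommRing A]
    (M M₁ M₂ : Type*) [AddCommGroup M] [Module A M]
    [AddCommGroup M₁] [Module A M₁] [AddCommGroup M₂] [Module A M₂]
    [Module.Finite A (M × M₁)] [Module.Free A (M × M₁)]
    [Module.Finite A (M × M₂)] [Module.Free A (M × M₂)]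
    (x : M →ₗ[A] M) :
    LinearMap.det (x.prodMap (LinearMap.id : M₁ →ₗ[A] M₁)) =
      LinearMap.det (x.prodMap (LinearMap.id : M₂ →ₗ[A] M₂)) := by
  -- Swapping the two copies of `M` in `(M × M₁) × (M × M₂)` conjugates `(x × id) × id`
  -- to `id × (x × id)`.
  let e : ((M × M₁) × (M × M₂)) ≃ₗ[A] ((M × M₁) × (M × M₂)) :=
    { toFun := fun p => ((p.2.1, p.1.2), (p.1.1, p.2.2))
      invFun := fun p => ((p.2.1, p.1.2), (p.1.1, p.2.2))
      map_add' := fun _ _ => rfl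
      map_smul' := fun _ _ => rfl
      left_inv := fun _ => rfl
      right_inv := fun _ => rfl }
  have h := LinearMap.det_conj
    ((x.prodMap (LinearMap.id : M₁ →ₗ[A] M₁)).prodMap (LinearMap.id : M × M₂ →ₗ[A] M × M₂)) e
  have he : (e : _ →ₗ[A] _) ∘ₗ ((x.prodMap (LinearMap.id : M₁ →ₗ[A] M₁)).prodMap
      (LinearMap.id : M × M₂ →ₗ[A] M × M₂)) ∘ₗ (e.symm : _ →ₗ[A] _) =
      (LinearMap.id : M × M₁ →ₗ[A] M × M₁).prodMap
        (x.prodMap (LinearMap.id : M₂ →ₗ[A] M₂)) :=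
    LinearMap.ext fun _ => rfl
  have h₁ := LinearMap.det_prodMap (x.prodMap (LinearMap.id : M₁ →ₗ[A] M₁))
    (LinearMap.id : M × M₂ →ₗ[A] M × M₂)
  have h₂ := LinearMap.det_prodMap (LinearMap.id : M × M₁ →ₗ[A] M × M₁)
    (x.prodMap (LinearMap.id : M₂ →ₗ[A] M₂))
  rw [LinearMap.det_id, mul_one] at h₁
  rw [LinearMap.det_id, one_mul] at h₂
  rw [he] at h
  exact h₁.symm.trans (h.symm.trans h₂)
end

section
/- Fix a prime p and a perfect field k of characteristic p, and let 𝔖 = W(k)[[u]] be the power series ring in the variable u over the ring W(k) of p-typical Witt vectors of k. Let M be an 𝔖-module killed by p^n for some positive integer n, and suppose there is a short exact sequence of 𝔖-modules 0 → 𝔖^d → 𝔖^d → M → 0 for some d. Then M is u-torsion free: for every m ∈ M, if u·m = 0 then m = 0. -/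
/-- If `f : R^ι → R^κ` is injective with cokernel `M` killed by `s`, and `r` is a nonzerodivisor
such that `r ∣ s * a` implies `r ∣ a`, then `r` acts injectively on `M`. -/
theorem eq_zero_of_smul_eq_zero_of_free_resolution
    {R ι κ M : Type*} [CommRing R] [AddCommGroup M] [Module R M] {r s : R}
    (hr : IsLeftRegular r) (hrs : ∀ a, r ∣ s * a → r ∣ a)
    (f : (ι → R) →ₗ[R] (κ → R)) (g : (κ → R) →ₗ[R] M)
    (hf : Function.Injective f) (hg : Function.Surjective g)
    (hexact : LinearMap.range f = LinearMap.ker g)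
    (hkill : ∀ m : M, s • m = 0) {m : M} (hm : r • m = 0) : m = 0 := by
  obtain ⟨x, rfl⟩ := hg m
  obtain ⟨y, hy⟩ : r • x ∈ LinearMap.range f := by
    rw [hexact, LinearMap.mem_ker, map_smul, hm]
  obtain ⟨z, hz⟩ : s • x ∈ LinearMap.range f := by
    rw [hexact, LinearMap.mem_ker, map_smul, hkill]
  have hyz : s • y = r • z := hf (by rw [map_smul, map_smul, hy, hz, smul_comm])
  choose w hw using fun i => hrs (y i) ⟨z i, congrFun hyz i⟩
  have hyw : y = r • w := funext hw
  have hx : x = f w := by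
    rw [hyw, map_smul] at hy
    exact funext fun i => hr (congrFun hy i).symm
  rw [← LinearMap.mem_ker, ← hexact, hx]
  exact LinearMap.mem_range_self f w

/-- Let `p` be a prime, `k` a perfect field of characteristic `p`, and
`𝔖 = W(k)[[u]]` the power series ring over the Witt vectors of `k`.
If `M` is an `𝔖`-module killed by `p ^ n` (`n > 0`) admitting a short exact sequence
`0 → 𝔖^d → 𝔖^d → M → 0`, then `M` is `u`-torsion free. -/
theorem u_torsionFree_of_twoTerm_free_resolution
    (p : ℕ) [Fact p.Prime] (k : Type*) [Field k] [CharP k p] [PerfectRing k p]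
    (n : ℕ) (hn : 0 < n) (d : ℕ)
    (M : Type*) [AddCommGroup M] [Module (PowerSeries (WittVector p k)) M]
    (hkill : ∀ m : M, (p : PowerSeries (WittVector p k)) ^ n • m = 0)
    (f : (Fin d → PowerSeries (WittVector p k)) →ₗ[PowerSeries (WittVector p k)]
         (Fin d → PowerSeries (WittVector p k)))
    (g : (Fin d → PowerSeries (WittVector p k)) →ₗ[PowerSeries (WittVector p k)] M)
    (hf : Function.Injective f) (hg : Function.Surjective g)
    (hexact : LinearMap.range f = LinearMap.ker g) :
    ∀ m : M, (PowerSeries.X : PowerSeries (WittVector p k)) • m = 0 → m = 0 := by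
  have hX := PowerSeries.X_prime (R := WittVector p k)
  have hp : ¬ (PowerSeries.X : PowerSeries (WittVector p k)) ∣
      (p : PowerSeries (WittVector p k)) ^ n := fun h => by
    have h' := hX.dvd_of_dvd_pow h
    rw [PowerSeries.X_dvd_iff, map_natCast] at h'
    exact WittVector.p_nonzero p k h'
  intro m hm
  exact eq_zero_of_smul_eq_zero_of_free_resolution
    (IsRegular.of_ne_zero hX.ne_zero).left
    (fun a ha => (hX.dvd_or_dvd ha).resolve_left hp) f g hf hg hexact hkill hm
end

section
/- Fix a prime p and a perfect field k of characteristic p, and let 𝔖 = W(k)[[u]]. Let M be a finitely generated 𝔖-module killed by p^n for some positive integer n. Then M admits a resolution 0 → 𝔖^d → 𝔖^d → M → 0 by finite free 𝔖-modules (i.e. M has projective dimension at most 1 with a two-term finite free resolution) if and only if u is a nonzerodivisor on M (u·m = 0 implies m = 0). -/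
/-- An `R`-module `M` admits a two-term resolution `0 → R^d → R^d → M → 0`
by finite free modules. -/
def HasTwoTermFreeResolution (R : Type*) [CommRing R]
    (M : Type*) [AddCommGroup M] [Module R M] : Prop :=
  ∃ (d : ℕ) (f : (Fin d → R) →ₗ[R] (Fin d → R)) (g : (Fin d → R) →ₗ[R] M),
    Function.Injective f ∧ Function.Surjective g ∧ LinearMap.range f = LinearMap.ker g

section TwoTermResolution

variable {A : Type*} [CommRing A] {x a : A}

lemma exists_smul_eq_of_smul_eq_smul_of_prime [IsDomain A] {ι : Type*} (hx : Prime x)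
    (ha : ¬ x ∣ a) {v w : ι → A} (h : a • v = x • w) : ∃ z : ι → A, v = x • z := by
  have key (i : ι) : x ∣ v i :=
    (hx.dvd_or_dvd ⟨w i, by simpa using congrFun h i⟩).resolve_left ha
  choose z hz using key
  exact ⟨z, funext fun i ↦ by simpa using hz i⟩

lemma HasTwoTermFreeResolution.eq_zero_of_smul_eq_zero [IsDomain A] {M : Type*}
    [AddCommGroup M] [Module A M] (h : HasTwoTermFreeResolution A M) (hx : Prime x)
    (ha : ¬ x ∣ a) (hM : ∀ m : M, a • m = 0) {m : M} (hm : x • m = 0) : m = 0 := by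
  obtain ⟨d, f, g, hf, hg, hfg⟩ := h
  have mem_range (v : Fin d → A) (hv : g v = 0) : ∃ y, f y = v :=
    LinearMap.mem_range.1 (hfg ▸ LinearMap.mem_ker.2 hv)
  obtain ⟨v, rfl⟩ := hg m
  obtain ⟨y, hy⟩ := mem_range (x • v) (by rw [map_smul, hm])
  obtain ⟨z, hz⟩ := mem_range (a • v) (by rw [map_smul, hM])
  obtain ⟨w, rfl⟩ : ∃ w, y = x • w := by
    refine exists_smul_eq_of_smul_eq_smul_of_prime hx ha (w := z) (hf ?_)
    rw [map_smul, map_smul, hy, hz, smul_comm]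
  have hv : f w = v := by
    rw [map_smul] at hy
    exact smul_right_injective _ hx.ne_zero hy
  have : f w ∈ LinearMap.ker g := hfg ▸ LinearMap.mem_range_self f w
  rwa [hv] at this

open Pointwise in
/-- Over a Noetherian domain `A` with a prime `x` in its Jacobson radical such that `A ⧸ (x)` is a
principal ideal ring, a submodule `K` of `A ^ ι` is free if `x` is regular on the quotient. -/
lemma Submodule.free_of_prime_of_isPrincipalIdealRing_quotient [IsDomain A] [IsNoetherianRing A]
    {ι : Type*} [Finite ι] (hx : Prime x) (hjac : x ∈ (⊥ : Ideal A).jacobson)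
    [IsPrincipalIdealRing (A ⧸ Ideal.span {x})] (K : Submodule A (ι → A))
    (hK : ∀ v, x • v ∈ K → v ∈ K) : Module.Free A K := by
  have : (Ideal.span {x}).IsPrime := (Ideal.span_singleton_prime hx.ne_zero).2 hx
  have : Module.FinitePresentation A K := Module.finitePresentation_of_finite A K
  rw [← Module.free_quotSMulTop_iff_free A K hjac
    (smul_right_injective K hx.ne_zero)]
  have : Module.Finite (A ⧸ Ideal.span {x}) (QuotSMulTop x K) :=
    Module.Finite.of_restrictScalars_finite A _ _
  have : Module.IsTorsionFree (A ⧸ Ideal.span {x}) (QuotSMulTop x K) := by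
    refine .of_smul_eq_zero fun r q h ↦ ?_
    obtain ⟨a, rfl⟩ := Ideal.Quotient.mk_surjective r
    obtain ⟨v, rfl⟩ := Submodule.mkQ_surjective _ q
    refine or_iff_not_imp_left.2 fun ha ↦ ?_
    rw [Ideal.Quotient.eq_zero_iff_mem, Ideal.mem_span_singleton] at ha
    have h' : a • v ∈ x • (⊤ : Submodule A K) := by
      rw [← Submodule.Quotient.mk_eq_zero]
      exact h
    obtain ⟨w, -, hw⟩ := (Submodule.mem_smul_pointwise_iff_exists _ _ _).1 h'
    obtain ⟨z, hz⟩ := exists_smul_eq_of_smul_eq_smul_of_prime hx ha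
      (congrArg Subtype.val hw).symm
    refine (Submodule.Quotient.mk_eq_zero _).2 ?_
    exact (Submodule.mem_smul_pointwise_iff_exists _ _ _).2
      ⟨⟨z, hK z (hz ▸ v.2)⟩, trivial, Subtype.ext hz.symm⟩
  infer_instance

/-- A free submodule `K` of `A ^ d` containing `a A ^ d` for some `a ≠ 0` has rank `d`. -/
lemma Submodule.finrank_eq_of_smul_mem [IsDomain A] [IsNoetherianRing A] {d : ℕ}
    (ha : a ≠ 0) (K : Submodule A (Fin d → A)) [Module.Free A K] (hK : ∀ v, a • v ∈ K) :
    Module.finrank A K = d := by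
  apply le_antisymm
  · simpa using LinearMap.finrank_le_finrank_of_injective K.injective_subtype
  · have : Function.Injective ((LinearMap.lsmul A (Fin d → A) a).codRestrict K hK) :=
      fun v w h ↦ smul_right_injective _ ha (congrArg Subtype.val h)
    simpa using LinearMap.finrank_le_finrank_of_injective this

lemma hasTwoTermFreeResolution_of_regular [IsDomain A] [IsNoetherianRing A] {M : Type*}
    [AddCommGroup M] [Module A M] [Module.Finite A M] (hx : Prime x)
    (hjac : x ∈ (⊥ : Ideal A).jacobson) [IsPrincipalIdealRing (A ⧸ Ideal.span {x})]
    (ha : a ≠ 0) (hM : ∀ m : M, a • m = 0) (hreg : ∀ m : M, x • m = 0 → m = 0) :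
    HasTwoTermFreeResolution A M := by
  obtain ⟨d, g, hg⟩ := Module.Finite.exists_fin' A M
  have : Module.Free A (LinearMap.ker g) :=
    Submodule.free_of_prime_of_isPrincipalIdealRing_quotient hx hjac _ fun v hv ↦
      hreg _ (by rwa [LinearMap.mem_ker, map_smul] at hv)
  have hrank : Module.finrank A (LinearMap.ker g) = d :=
    Submodule.finrank_eq_of_smul_mem ha _ fun v ↦ by rw [LinearMap.mem_ker, map_smul, hM]
  let e := (Module.finBasisOfFinrankEq A (LinearMap.ker g) hrank).equivFun.symm
  refine ⟨d, (LinearMap.ker g).subtype ∘ₗ e.toLinearMap, g, ?_, hg, ?_⟩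
  · simpa using e.injective
  · rw [LinearMap.range_comp, LinearEquiv.range, Submodule.map_top, Submodule.range_subtype]

end TwoTermResolution

namespace PowerSeries

variable {R : Type*} [CommRing R]

lemma X_mem_jacobson_bot : (X : PowerSeries R) ∈ (⊥ : Ideal (PowerSeries R)).jacobson := by
  rw [Ideal.mem_jacobson_bot]
  intro y
  simp [isUnit_iff_constantCoeff]

lemma isPrincipalIdealRing_quotient_span_X [IsPrincipalIdealRing R] :
    IsPrincipalIdealRing (PowerSeries R ⧸ Ideal.span {(X : PowerSeries R)}) := by
  refine IsPrincipalIdealRing.of_surjective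
    ((Ideal.Quotient.mk (Ideal.span {(X : PowerSeries R)})).comp (C (R := R))) fun q ↦ ?_
  obtain ⟨f, rfl⟩ := Ideal.Quotient.mk_surjective q
  refine ⟨constantCoeff f, ?_⟩
  rw [RingHom.comp_apply, Ideal.Quotient.eq, Ideal.mem_span_singleton, X_dvd_iff]
  simp

end PowerSeries

/-- Let `p` be a prime, `k` a perfect field of characteristic `p`, and
`𝔖 = W(k)[[u]]`.  A finitely generated `𝔖`-module `M` killed by `p ^ n` (`n > 0`)
admits a resolution `0 → 𝔖^d → 𝔖^d → M → 0` by finite free `𝔖`-modules if and only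
if `u` is a nonzerodivisor on `M`. -/
theorem twoTermFreeResolution_iff_u_regular
    (p : ℕ) [Fact p.Prime] (k : Type*) [Field k] [CharP k p] [PerfectRing k p]
    (n : ℕ) (hn : 0 < n)
    (M : Type*) [AddCommGroup M] [Module (PowerSeries (WittVector p k)) M]
    [Module.Finite (PowerSeries (WittVector p k)) M]
    (hkill : ∀ m : M, (p : PowerSeries (WittVector p k)) ^ n • m = 0) :
    HasTwoTermFreeResolution (PowerSeries (WittVector p k)) M ↔
      ∀ m : M, (PowerSeries.X : PowerSeries (WittVector p k)) • m = 0 → m = 0 := by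
  have hp : (p : WittVector p k) ^ n ≠ 0 := pow_ne_zero n (WittVector.p_nonzero p k)
  have hX : ¬ (PowerSeries.X : PowerSeries (WittVector p k)) ∣
      (p : PowerSeries (WittVector p k)) ^ n := by
    rw [PowerSeries.X_dvd_iff]
    simpa using hp
  have := PowerSeries.isPrincipalIdealRing_quotient_span_X (R := WittVector p k)
  exact ⟨fun h m hm ↦ h.eq_zero_of_smul_eq_zero PowerSeries.X_prime hX hkill hm,
    hasTwoTermFreeResolution_of_regular PowerSeries.X_prime PowerSeries.X_mem_jacobson_bot
      (fun h ↦ hX (by simp [h])) hkill⟩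
end

section
/- Let p be a prime, k a perfect field of characteristic p, and φ the Frobenius endomorphism x ↦ x^p of k[[u]]. Fix integers h ≥ 1 and e ≥ 1 and a subset Φ ⊆ ℤ/hℤ. Let C be the h × h matrix over k[[u]], with rows and columns indexed by ℤ/hℤ, defined by C_{j+1, j} = u^e if j ∈ Φ, C_{j+1, j} = 1 if j ∉ Φ, and all other entries equal to 0. Then the h-fold Frobenius-twisted product C · C^{(φ)} · C^{(φ²)} ⋯ C^{(φ^{h−1})} (where C^{(φ^r)} raises each entry of C to the p^r-th power) is a diagonal matrix whose (i, i)-entry equals u^{e · Σ_{α ∈ Φ} p^{h − 1 − ((α − i) mod h)}}, where (α − i) mod h denotes the representative in {0, 1, …, h−1} of the residue α − i in ℤ/hℤ. -/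
theorem prod_map_pow_of_cyclic_support {R : Type*} [CommSemiring R] {h : ℕ} [NeZero h]
    (q : ℕ → ℕ) (hq : ∀ r, q r ≠ 0) (f : ZMod h → R) (C : Matrix (ZMod h) (ZMod h) R)
    (hC : ∀ i j, C i j = if i = j + 1 then f j else 0) (n : ℕ) (i j : ZMod h) :
    ((List.range n).map fun r => C.map fun x => x ^ q r).prod i j =
      if i = j + n then ∏ r ∈ Finset.range n, f (i - r - 1) ^ q r else 0 := by
  induction n generalizing j with
  | zero => simp [Matrix.one_apply]
  | succ n ih =>
    rw [List.range_succ, List.map_append, List.prod_append, List.map_singleton,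
      List.prod_singleton, Matrix.mul_apply, Finset.sum_eq_single (j + 1)]
    · rw [ih, Matrix.map_apply, hC, if_pos rfl, Finset.prod_range_succ, Nat.cast_succ]
      have hij : i = j + 1 + n ↔ i = j + (n + 1) := by rw [add_assoc, add_comm (1 : ZMod h)]
      by_cases hi : i = j + (n + 1)
      · rw [if_pos (hij.2 hi), if_pos hi]
        have hj : i - n - 1 = j := by rw [hi]; ring
        rw [hj]
      · rw [if_neg (mt hij.1 hi), if_neg hi, zero_mul]
    · intro l _ hl
      rw [Matrix.map_apply, hC, if_neg hl, zero_pow (hq n), mul_zero]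
    · simp

theorem ZMod.val_neg_natCast_sub_one {h r : ℕ} [NeZero h] (hr : r < h) :
    (-(r : ZMod h) - 1).val = h - 1 - r := by
  have hcast : -(r : ZMod h) - 1 = ((h - 1 - r : ℕ) : ZMod h) := by
    have hsum : ((h - 1 - r + r + 1 : ℕ) : ZMod h) = 0 := by
      rw [show h - 1 - r + r + 1 = h by omega, ZMod.natCast_self]
    push_cast at hsum
    linear_combination -hsum
  rw [hcast, ZMod.val_natCast_of_lt (by omega)]

theorem sum_range_eq_sum_zmod {M : Type*} [AddCommMonoid M] {h : ℕ} [NeZero h]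
    (i : ZMod h) (g : ZMod h → ℕ → M) :
    ∑ r ∈ Finset.range h, g (i - r - 1) r = ∑ α, g α (h - 1 - (α - i).val) := by
  have hval (r : ℕ) (hr : r < h) : (i - r - 1 - i).val = h - 1 - r := by
    rw [← ZMod.val_neg_natCast_sub_one hr]
    congr 1
    ring
  refine Finset.sum_bij' (fun r _ => i - r - 1) (fun α _ => h - 1 - (α - i).val) ?_ ?_ ?_ ?_ ?_
  · simp
  · intro α _
    have := NeZero.pos h
    rw [Finset.mem_range]
    omega
  · intro r hr
    rw [Finset.mem_range] at hr
    rw [hval r hr]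
    omega
  · intro α _
    have hlt := ZMod.val_lt (α - i)
    have hsum : ((h - 1 - (α - i).val + (α - i).val + 1 : ℕ) : ZMod h) = 0 := by
      rw [show h - 1 - (α - i).val + (α - i).val + 1 = h by omega, ZMod.natCast_self]
    rw [Nat.cast_add, Nat.cast_add, ZMod.natCast_zmod_val, Nat.cast_one] at hsum
    linear_combination -hsum
  · intro r hr
    rw [Finset.mem_range] at hr
    rw [hval r hr, show h - 1 - (h - 1 - r) = r by omega]

/-- Let `k` be a perfect field of characteristic `p`, `h ≥ 1`, `e ≥ 1`, and
`Φ ⊆ ℤ/hℤ`.  Let `C` be the `h × h` matrix over `k[[u]]` with `C (j+1) j = u^e`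
for `j ∈ Φ`, `C (j+1) j = 1` for `j ∉ Φ`, and all other entries `0`.  Then the
`h`-fold Frobenius-twisted product `C · C^(φ) · ⋯ · C^(φ^(h-1))` (where the `r`-th
factor raises each entry to the `p^r`-th power) is the diagonal matrix whose
`(i, i)`-entry is `u ^ (e * Σ_{α ∈ Φ} p ^ (h - 1 - ((α - i) mod h)))`. -/
theorem frobenius_twisted_product_of_CM_cycle_matrix
    (p : ℕ) [Fact p.Prime] (k : Type*) [Field k] [CharP k p] [PerfectRing k p]
    (h : ℕ) [NeZero h] (hh : 1 ≤ h) (e : ℕ) (he : 1 ≤ e)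
    (Φ : Finset (ZMod h))
    (C : Matrix (ZMod h) (ZMod h) (PowerSeries k))
    (hC : ∀ i j : ZMod h, C i j =
      if i = j + 1 then (if j ∈ Φ then (PowerSeries.X : PowerSeries k) ^ e else 1) else 0) :
    (((List.range h).map fun r => C.map fun x => x ^ p ^ r).prod) =
      Matrix.diagonal fun i : ZMod h =>
        (PowerSeries.X : PowerSeries k) ^ (e * ∑ α ∈ Φ, p ^ (h - 1 - (α - i).val)) := by
  ext1 i j
  rw [prod_map_pow_of_cyclic_support (fun r => p ^ r)
    (fun r => pow_ne_zero r (Fact.out : p.Prime).ne_zero) _ C hC, ZMod.natCast_self, add_zero,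
    Matrix.diagonal_apply]
  refine if_congr Iff.rfl ?_ rfl
  have hfactor (r : ℕ) : (if i - r - 1 ∈ Φ then (PowerSeries.X : PowerSeries k) ^ e else 1) ^ p ^ r =
      PowerSeries.X ^ (if i - r - 1 ∈ Φ then e * p ^ r else 0) := by
    split_ifs <;> simp [pow_mul]
  rw [Finset.prod_congr rfl fun r _ => hfactor r, Finset.prod_pow_eq_pow_sum,
    sum_range_eq_sum_zmod i fun α r => if α ∈ Φ then e * p ^ r else 0, Finset.mul_sum,
    Finset.sum_ite_mem, Finset.univ_inter]
end

section
/- Let p ≥ 2 be an integer and let h = δ·m with integers δ ≥ 1 and m ≥ 1. For every subset Φ ⊆ ℤ/hℤ with exactly m elements, there exists τ ∈ ℤ/hℤ such that Σ_{α ∈ Φ} p^{h − 1 − ((α − τ) mod h)} ≤ 1 + p^{δ} + p^{2δ} + ⋯ + p^{(m−1)δ} = (p^{h} − 1)/(p^{δ} − 1). Moreover, when Φ is an arithmetic progression in ℤ/hℤ with common difference δ (i.e. Φ = {a, a + δ, …, a + (m−1)δ} for some a), the minimum over τ ∈ ℤ/hℤ of Σ_{α ∈ Φ} p^{h − 1 −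 ((α − τ) mod h)} equals exactly (p^{h} − 1)/(p^{δ} − 1). -/
/-- The sum of `p ^ (h - 1 - ((α - τ) mod h))` over `α ∈ Φ`. -/
def cmWeight (p h : ℕ) (Φ : Finset (ZMod h)) (τ : ZMod h) : ℕ :=
  ∑ α ∈ Φ, p ^ (h - 1 - (α - τ).val)

lemma pow_sub_val_sub_one {p h : ℕ} [NeZero h] (hp : 1 ≤ p) (x : ZMod h) :
    p ^ (h - 1 - (x - 1).val) + (if x = 0 then p ^ h - 1 else 0) =
      p * p ^ (h - 1 - x.val) := by
  have hpos : 0 < h := Nat.pos_of_ne_zero (NeZero.ne h)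
  obtain ⟨n, rfl⟩ : ∃ n, h = n + 1 := ⟨h - 1, by omega⟩
  have hpow : 1 ≤ p ^ (n + 1) := Nat.one_le_pow _ _ hp
  by_cases hx : x = 0
  · subst hx
    rw [zero_sub, ZMod.val_neg_one, if_pos rfl, ZMod.val_zero, ← pow_succ']
    simp
    omega
  · have hv : x.val ≠ 0 := by simpa [ZMod.val_eq_zero] using hx
    have hlt := ZMod.val_lt x
    have hval : (x - 1).val = x.val - 1 := by
      have hcast : x - 1 = ((x.val - 1 : ℕ) : ZMod (n + 1)) := by
        rw [Nat.cast_sub (by omega), ZMod.natCast_zmod_val, Nat.cast_one]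
      rw [hcast, ZMod.val_natCast, Nat.mod_eq_of_lt (by omega)]
    rw [if_neg hx, hval, ← pow_succ', add_zero]
    congr 1
    omega

lemma cmWeight_add_one {p h : ℕ} [NeZero h] (hp : 1 ≤ p) (Φ : Finset (ZMod h)) (τ : ZMod h) :
    cmWeight p h Φ (τ + 1) + (if τ ∈ Φ then p ^ h - 1 else 0) = p * cmWeight p h Φ τ := by
  have hterm : (∑ α ∈ Φ, if α - τ = 0 then p ^ h - 1 else 0) =
      if τ ∈ Φ then p ^ h - 1 else 0 := by
    simp [sub_eq_zero]
  rw [← hterm, cmWeight, cmWeight, ← Finset.sum_add_distrib, Finset.mul_sum]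
  refine Finset.sum_congr rfl fun α _ => ?_
  rw [← pow_sub_val_sub_one hp (α - τ), sub_sub]

lemma cmWeight_add_natCast_modEq {p h : ℕ} [NeZero h] (hp : 1 ≤ p) (Φ : Finset (ZMod h))
    (τ : ZMod h) (k : ℕ) :
    cmWeight p h Φ (τ + k) ≡ p ^ k * cmWeight p h Φ τ [MOD p ^ h - 1] := by
  induction k with
  | zero => simp [Nat.ModEq.refl]
  | succ k ih =>
    have hstep : cmWeight p h Φ (τ + k + 1) ≡ p * cmWeight p h Φ (τ + k) [MOD p ^ h - 1] := by
      rw [← cmWeight_add_one hp]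
      split_ifs
      · simp [Nat.ModEq]
      · exact Nat.ModEq.refl _
    rw [Nat.cast_succ, ← add_assoc, pow_succ', mul_assoc]
    exact hstep.trans (ih.mul_left p)

lemma sum_pow_mul_mul_pred {p : ℕ} (hp : 1 ≤ p) (δ m : ℕ) :
    (∑ i ∈ Finset.range m, p ^ (i * δ)) * (p ^ δ - 1) = p ^ (δ * m) - 1 := by
  have h := geom_sum_mul_of_one_le (Nat.one_le_pow δ p hp) m
  simpa only [← pow_mul, mul_comm δ] using h

lemma exists_cmWeight_le {p h δ m : ℕ} [NeZero h] (hp : 2 ≤ p) (hδ : 1 ≤ δ) (hm : 1 ≤ m)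
    (hh : h = δ * m) {Φ : Finset (ZMod h)} (hΦ : Φ.card = m) :
    ∃ τ, cmWeight p h Φ τ ≤ ∑ i ∈ Finset.range m, p ^ (i * δ) := by
  by_contra! hlarge
  have hgeom := sum_pow_mul_mul_pred (by omega : 1 ≤ p) δ m
  rw [← hh] at hgeom
  have hpδ : 1 < p ^ δ := Nat.one_lt_pow (by omega) (by omega)
  have hpos (τ) : 0 < cmWeight p h Φ τ := (Nat.zero_le _).trans_lt (hlarge τ)
  have hmem {τ} (hτ : τ ∈ Φ) :
      p * cmWeight p h Φ τ < cmWeight p h Φ (τ + 1) * (if τ ∈ Φ then p ^ δ else 1) := by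
    rw [← cmWeight_add_one (by omega), if_pos hτ, if_pos hτ, ← hgeom]
    obtain ⟨q, hq⟩ : ∃ q, p ^ δ = q + 1 := ⟨p ^ δ - 1, by omega⟩
    have hlt := Nat.mul_lt_mul_of_pos_right (hlarge (τ + 1)) (show 0 < q by omega)
    rw [hq, Nat.add_sub_cancel, mul_add]
    omega
  obtain ⟨σ, hσ⟩ : Φ.Nonempty := Finset.card_pos.mp (by omega)
  have hprod : ∏ τ, p * cmWeight p h Φ τ <
      ∏ τ, cmWeight p h Φ (τ + 1) * (if τ ∈ Φ then p ^ δ else 1) := by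
    refine Finset.prod_lt_prod (fun τ _ => Nat.mul_pos (by omega) (hpos τ)) (fun τ _ => ?_)
      ⟨σ, Finset.mem_univ σ, hmem hσ⟩
    by_cases hτ : τ ∈ Φ
    · exact (hmem hτ).le
    · rw [← cmWeight_add_one (by omega), if_neg hτ, if_neg hτ, add_zero, mul_one]
  have hshift : ∏ τ, cmWeight p h Φ (τ + 1) = ∏ τ, cmWeight p h Φ τ :=
    Equiv.prod_comp (Equiv.addRight (1 : ZMod h)) (cmWeight p h Φ)
  have hpow : (∏ τ, if τ ∈ Φ then p ^ δ else 1) = p ^ h := by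
    rw [Finset.prod_ite_mem, Finset.univ_inter, Finset.prod_const, hΦ, ← pow_mul, ← hh]
  rw [Finset.prod_mul_distrib, Finset.prod_mul_distrib, hshift, hpow, Finset.prod_const,
    Finset.card_univ, ZMod.card, mul_comm] at hprod
  exact lt_irrefl _ hprod

lemma injOn_add_natCast_mul {h δ m : ℕ} (hδ : 1 ≤ δ) (hh : h = δ * m) (a : ZMod h) :
    Set.InjOn (fun i : ℕ => a + (i * δ : ℕ)) (Finset.range m) := by
  intro i hi j hj hij
  have hlt {k : ℕ} (hk : k ∈ (Finset.range m : Set ℕ)) : k * δ < h := by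
    rw [hh, mul_comm δ]
    exact Nat.mul_lt_mul_of_pos_right (by simpa using hk) hδ
  have hcast := (ZMod.natCast_eq_natCast_iff' _ _ _).mp (add_left_cancel hij)
  rw [Nat.mod_eq_of_lt (hlt hi), Nat.mod_eq_of_lt (hlt hj)] at hcast
  exact Nat.eq_of_mul_eq_mul_right hδ hcast

lemma cmWeight_image_add_natCast {p h δ m : ℕ} (hδ : 1 ≤ δ)
    (hh : h = δ * m) (a τ : ZMod h) :
    cmWeight p h ((Finset.range m).image fun i : ℕ => a + (i * δ : ℕ)) (τ + δ) =
      cmWeight p h ((Finset.range m).image fun i : ℕ => a + (i * δ : ℕ)) τ := by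
  have hinj := injOn_add_natCast_mul hδ hh a
  rw [cmWeight, cmWeight, Finset.sum_image hinj, Finset.sum_image hinj]
  set G : ℕ → ℕ := fun i => p ^ (h - 1 - (a + (i * δ : ℕ) - (τ + δ)).val) with hG
  have hG_succ (i : ℕ) : p ^ (h - 1 - (a + (i * δ : ℕ) - τ).val) = G (i + 1) := by
    simp only [hG]
    congr 3
    push_cast
    ring
  have hperiod : G m = G 0 := by
    simp only [hG]
    rw [mul_comm m, ← hh]
    simp
  simp only [hG_succ]
  have hsum := (Finset.sum_range_succ G m).symm.trans (Finset.sum_range_succ' G m)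
  rw [hperiod] at hsum
  exact Nat.add_right_cancel hsum

lemma sum_pow_le_cmWeight_image {p h δ m : ℕ} [NeZero h] (hp : 2 ≤ p) (hδ : 1 ≤ δ)
    (hm : 1 ≤ m) (hh : h = δ * m) (a τ : ZMod h) :
    ∑ i ∈ Finset.range m, p ^ (i * δ) ≤
      cmWeight p h ((Finset.range m).image fun i : ℕ => a + (i * δ : ℕ)) τ := by
  set Φ := (Finset.range m).image fun i : ℕ => a + (i * δ : ℕ) with hΦ
  have hmod := cmWeight_add_natCast_modEq (by omega : 1 ≤ p) Φ τ δ
  rw [hΦ, cmWeight_image_add_natCast hδ hh, ← hΦ] at hmod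
  have hpδ : 1 < p ^ δ := Nat.one_lt_pow (by omega) (by omega)
  have hpos : 0 < cmWeight p h Φ τ :=
    Finset.sum_pos (fun _ _ => Nat.pow_pos (by omega))
      ((Finset.nonempty_range_iff.mpr (by omega)).image _)
  have hdvd := (Nat.modEq_iff_dvd' (Nat.le_mul_of_pos_left _ (by omega))).mp hmod
  have hgeom := sum_pow_mul_mul_pred (by omega : 1 ≤ p) δ m
  rw [← hh] at hgeom
  rw [← Nat.sub_one_mul, ← hgeom, mul_comm] at hdvd
  exact Nat.le_of_dvd hpos (Nat.dvd_of_mul_dvd_mul_left (by omega) hdvd)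

/-- Let `p ≥ 2` and `h = δ * m` with `δ, m ≥ 1`.  For every `Φ ⊆ ℤ/hℤ` with `m`
elements there is `τ ∈ ℤ/hℤ` with
`Σ_{α ∈ Φ} p ^ (h - 1 - ((α - τ) mod h)) ≤ 1 + p^δ + ⋯ + p^((m-1)δ)`; moreover,
if `Φ` is an arithmetic progression of common difference `δ`, the minimum over `τ`
of this sum equals exactly `1 + p^δ + ⋯ + p^((m-1)δ) = (p^h - 1)/(p^δ - 1)`. -/
theorem cm_type_weight_min_bound
    (p h δ m : ℕ) (hp : 2 ≤ p) (hδ : 1 ≤ δ) (hm : 1 ≤ m) (hh : h = δ * m) :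
    (∀ Φ : Finset (ZMod h), Φ.card = m →
      ∃ τ : ZMod h,
        ∑ α ∈ Φ, p ^ (h - 1 - (α - τ).val) ≤ ∑ i ∈ Finset.range m, p ^ (i * δ)) ∧
    (∀ Φ : Finset (ZMod h),
      (∃ a : ZMod h, Φ = (Finset.range m).image fun i : ℕ => a + (i * δ : ℕ)) →
      IsLeast {s : ℕ | ∃ τ : ZMod h, s = ∑ α ∈ Φ, p ^ (h - 1 - (α - τ).val)}
        (∑ i ∈ Finset.range m, p ^ (i * δ))) := by
  have : NeZero h := ⟨by rw [hh]; positivity⟩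
  refine ⟨fun Φ hΦ => exists_cmWeight_le hp hδ hm hh hΦ, ?_⟩
  rintro Φ ⟨a, rfl⟩
  refine ⟨?_, ?_⟩
  · obtain ⟨τ, hτ⟩ := exists_cmWeight_le hp hδ hm hh
      ((Finset.card_image_of_injOn (injOn_add_natCast_mul hδ hh a)).trans (Finset.card_range m))
    exact ⟨τ, (sum_pow_le_cmWeight_image hp hδ hm hh a τ).antisymm hτ⟩
  · rintro s ⟨τ, rfl⟩
    exact sum_pow_le_cmWeight_image hp hδ hm hh a τ
end
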